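/- Let ♯(P_n) = n·A(2n−1), where A(m) denotes the number of 2up-2down permutations of {1,…,m}. Then, in the ring of formal power series with real coefficients, 2·(Σ_{n≥1} ♯(P_n) x^{2n}/(2n)!) · (φ₀(x)² − φ₁(x)φ₃(x)) = x·(φ₀(x)φ₁(x) − φ₂(x)φ₃(x) + φ₃(x)). -/

import Mathlib

/-- A permutation of `{1,…,m}` (encoded as `Fin m`, 0-indexed) is 2up-2down if (in 1-based
positions) `σ(i) < σ(i+1)` exactly when `i ≡ 1, 2 (mod 4)`; with 0-based index `i`
this reads `σ(i) < σ(i+1) ↔ i % 4 < 2`. -/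
def Is2Up2Down {m : ℕ} (σ : Equiv.Perm (Fin m)) : Prop :=
  ∀ i : ℕ, ∀ h : i + 1 < m, (σ ⟨i, by omega⟩ < σ ⟨i + 1, h⟩ ↔ i % 4 < 2)

/-- `A m` is the number of 2up-2down permutations of `{1,…,m}`. -/
noncomputable def numTwoUpTwoDown (m : ℕ) : ℕ :=
  Nat.card {σ : Equiv.Perm (Fin m) // Is2Up2Down σ}

/-- `♯(P_n) = n · A(2n−1)`, the number of nonequivalent properly oriented and labeled
planar chord diagrams of `P_n`-type. -/
noncomputable def sharpP (n : ℕ) : ℕ := n * numTwoUpTwoDown (2 * n - 1)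

/-- The `j`-th Olivier function `φ_j(x) = Σ_{k≥0} x^{4k+j}/(4k+j)!` as a real formal
power series. -/
noncomputable def olivier (j : ℕ) : PowerSeries ℝ :=
  PowerSeries.mk fun n => if n % 4 = j then (1 : ℝ) / n.factorial else 0

/-- `F_P(x) = Σ_{n≥1} ♯(P_n) x^{2n}/(2n)!` as a real formal power series; the coefficient
of `x^m` is `♯(P_{m/2})/m!` for even `m ≥ 2` and `0` otherwise. -/
noncomputable def FP : PowerSeries ℝ :=
  PowerSeries.mk fun m =>
    if m % 2 = 0 ∧ m ≠ 0 then (sharpP (m / 2) : ℝ) / m.factorial else 0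

/-- The number of permutations `σ` of `Fin m` whose up-down sequence is the restriction of `w`:
`σ i < σ (i + 1)` exactly when `w i`. -/
noncomputable def upDownCount (m : ℕ) (w : ℕ → Prop) : ℕ :=
  Nat.card {σ : Equiv.Perm (Fin m) //
    ∀ i : ℕ, ∀ h : i + 1 < m, (σ ⟨i, by omega⟩ < σ ⟨i + 1, h⟩ ↔ w i)}

theorem upDownCount_congr {m : ℕ} {w w' : ℕ → Prop} (h : ∀ i, i + 1 < m → (w i ↔ w' i)) :
    upDownCount m w = upDownCount m w' := by
  refine Nat.card_congr (Equiv.subtypeEquivRight fun σ => ?_)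
  exact forall₂_congr fun i hi => by rw [h i hi]

theorem upDownCount_of_forall {m : ℕ} {w : ℕ → Prop} (h : ∀ i, i + 1 < m → w i) :
    upDownCount m w = 1 := by
  rw [upDownCount, Nat.card_eq_one_iff_unique]
  have mono : ∀ σ : Equiv.Perm (Fin m),
      (∀ i : ℕ, ∀ h : i + 1 < m, (σ ⟨i, by omega⟩ < σ ⟨i + 1, h⟩ ↔ w i)) → StrictMono σ := by
    intro σ hσ
    cases m with
    | zero => exact fun a => a.elim0
    | succ m =>
      rw [Fin.strictMono_iff_lt_succ]
      intro i
      exact (hσ i (by omega)).2 (h i (by omega))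
  refine ⟨⟨fun a b => ?_⟩, ⟨⟨1, fun i hi => ?_⟩⟩⟩
  · apply Subtype.ext
    apply DFunLike.coe_injective
    apply (StrictMono.range_inj (mono _ a.2) (mono _ b.2)).1
    rw [a.1.surjective.range_eq, b.1.surjective.range_eq]
  · simp [h i hi, Fin.lt_def]

theorem card_compl_of_card {n m : ℕ} (S : {S : Finset (Fin (n + m)) // S.card = n}) :
    (S.1ᶜ).card = m := by
  rw [Finset.card_compl, S.2]; simp

/-- The permutation of `Fin (n + m)` that maps the first `n` positions onto `S` in the relative
order given by `α`, and the last `m` positions onto the complement of `S` in the relative order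
given by `β`. -/
def shufflePerm {n m : ℕ}
    (p : {S : Finset (Fin (n + m)) // S.card = n} × Equiv.Perm (Fin n) × Equiv.Perm (Fin m)) :
    Equiv.Perm (Fin (n + m)) :=
  finSumFinEquiv.symm.trans ((Equiv.sumCongr p.2.1 p.2.2).trans
    (finSumEquivOfFinset p.1.2 (card_compl_of_card p.1)))

theorem shufflePerm_castAdd {n m : ℕ}
    (p : {S : Finset (Fin (n + m)) // S.card = n} × Equiv.Perm (Fin n) × Equiv.Perm (Fin m))
    (i : Fin n) :
    shufflePerm p (Fin.castAdd m i) = p.1.1.orderEmbOfFin p.1.2 (p.2.1 i) := by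
  simp [shufflePerm]

theorem shufflePerm_natAdd {n m : ℕ}
    (p : {S : Finset (Fin (n + m)) // S.card = n} × Equiv.Perm (Fin n) × Equiv.Perm (Fin m))
    (i : Fin m) :
    shufflePerm p (Fin.natAdd n i) =
      (p.1.1ᶜ).orderEmbOfFin (card_compl_of_card p.1) (p.2.2 i) := by
  simp [shufflePerm]

theorem range_shufflePerm_castAdd {n m : ℕ}
    (p : {S : Finset (Fin (n + m)) // S.card = n} × Equiv.Perm (Fin n) × Equiv.Perm (Fin m)) :
    Set.range (fun i => shufflePerm p (Fin.castAdd m i)) = p.1.1 := by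
  rw [← Finset.range_orderEmbOfFin p.1.1 p.1.2]
  simp only [shufflePerm_castAdd]
  exact p.2.1.surjective.range_comp (p.1.1.orderEmbOfFin p.1.2)

theorem shufflePerm_bijective (n m : ℕ) : Function.Bijective (@shufflePerm n m) := by
  rw [Fintype.bijective_iff_injective_and_card]
  constructor
  · rintro ⟨S, α, β⟩ ⟨S', α', β'⟩ h
    have hS : S = S' := by
      apply Subtype.ext
      apply Finset.coe_injective
      rw [← range_shufflePerm_castAdd ⟨S, α, β⟩, ← range_shufflePerm_castAdd ⟨S', α', β'⟩, h]
    subst hS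
    have hα : α = α' := by
      ext1 i
      have := DFunLike.congr_fun h (Fin.castAdd m i)
      simpa only [shufflePerm_castAdd, EmbeddingLike.apply_eq_iff_eq] using this
    have hβ : β = β' := by
      ext1 i
      have := DFunLike.congr_fun h (Fin.natAdd n i)
      simpa only [shufflePerm_natAdd, EmbeddingLike.apply_eq_iff_eq] using this
    rw [hα, hβ]
  · simp only [Fintype.card_prod, Fintype.card_finset_len, Fintype.card_perm, Fintype.card_fin]
    rw [← Nat.add_choose_mul_factorial_mul_factorial, mul_assoc, Nat.choose_symm_add]

/-- Leaving the comparison between positions `n` and `n + 1` free splits a permutation of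
`n + m` elements into two independent ones. -/
theorem card_upDown_except (n m : ℕ) (w : ℕ → Prop) :
    Nat.card {σ : Equiv.Perm (Fin (n + m)) // ∀ i : ℕ, ∀ h : i + 1 < n + m, i + 1 ≠ n →
      (σ ⟨i, by omega⟩ < σ ⟨i + 1, h⟩ ↔ w i)} =
    (n + m).choose n * (upDownCount n w * upDownCount m fun i => w (n + i)) := by
  have key : ∀ p : {S : Finset (Fin (n + m)) // S.card = n} ×
        Equiv.Perm (Fin n) × Equiv.Perm (Fin m),
      (True ∧ (∀ i : ℕ, ∀ h : i + 1 < n, (p.2.1 ⟨i, by omega⟩ < p.2.1 ⟨i + 1, h⟩ ↔ w i)) ∧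
        ∀ i : ℕ, ∀ h : i + 1 < m, (p.2.2 ⟨i, by omega⟩ < p.2.2 ⟨i + 1, h⟩ ↔ w (n + i))) ↔
      ∀ i : ℕ, ∀ h : i + 1 < n + m, i + 1 ≠ n →
        (shufflePerm p ⟨i, by omega⟩ < shufflePerm p ⟨i + 1, h⟩ ↔ w i) := by
    intro p
    have first : ∀ i : ℕ, ∀ h : i + 1 < n,
        (shufflePerm p ⟨i, by omega⟩ < shufflePerm p ⟨i + 1, by omega⟩ ↔
          p.2.1 ⟨i, by omega⟩ < p.2.1 ⟨i + 1, h⟩) := by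
      intro i h
      have h1 := shufflePerm_castAdd p ⟨i, by omega⟩
      have h2 := shufflePerm_castAdd p ⟨i + 1, h⟩
      rw [Fin.castAdd_mk] at h1 h2
      rw [h1, h2, OrderEmbedding.lt_iff_lt]
    have second : ∀ i : ℕ, ∀ h : i + 1 < m,
        (shufflePerm p ⟨n + i, by omega⟩ < shufflePerm p ⟨n + i + 1, by omega⟩ ↔
          p.2.2 ⟨i, by omega⟩ < p.2.2 ⟨i + 1, h⟩) := by
      intro i h
      have h1 := shufflePerm_natAdd p ⟨i, by omega⟩
      have h2 := shufflePerm_natAdd p ⟨i + 1, h⟩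
      rw [Fin.natAdd_mk] at h1 h2
      simp only [add_assoc]
      rw [h1, h2, OrderEmbedding.lt_iff_lt]
    constructor
    · rintro ⟨-, hα, hβ⟩ i h hn
      rcases lt_or_ge (i + 1) n with hi | hi
      · rw [first i hi, hα i hi]
      · obtain ⟨j, rfl⟩ := Nat.exists_eq_add_of_le (show n ≤ i by omega)
        rw [second j (by omega), hβ j (by omega)]
    · intro H
      refine ⟨trivial, fun i h => ?_, fun i h => ?_⟩
      · rw [← first i h, H i (by omega) (by omega)]
      · rw [← second i h, H (n + i) (by omega) (by omega)]
  rw [← Nat.card_congr ((Equiv.ofBijective _ (shufflePerm_bijective n m)).subtypeEquiv key),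
    Nat.card_congr (Equiv.subtypeProdEquivProd (p := fun _ => True)
      (q := fun αβ : Equiv.Perm (Fin n) × Equiv.Perm (Fin m) =>
        (∀ i : ℕ, ∀ h : i + 1 < n, (αβ.1 ⟨i, by omega⟩ < αβ.1 ⟨i + 1, h⟩ ↔ w i)) ∧
          ∀ i : ℕ, ∀ h : i + 1 < m, (αβ.2 ⟨i, by omega⟩ < αβ.2 ⟨i + 1, h⟩ ↔ w (n + i)))),
    Nat.card_prod,
    Nat.card_congr (Equiv.subtypeUnivEquiv fun _ => trivial), Nat.card_congr
      (Equiv.subtypeProdEquivProd (p := fun α : Equiv.Perm (Fin n) => ∀ i : ℕ, ∀ h : i + 1 < n,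
        (α ⟨i, by omega⟩ < α ⟨i + 1, h⟩ ↔ w i)) (q := fun β : Equiv.Perm (Fin m) =>
        ∀ i : ℕ, ∀ h : i + 1 < m, (β ⟨i, by omega⟩ < β ⟨i + 1, h⟩ ↔ w (n + i)))),
    Nat.card_prod, Nat.card_eq_fintype_card, Fintype.card_finset_len, Fintype.card_fin]
  rfl

/-- Two words that differ only at the letter `n` (an ascent in `w`, a descent in `w'`). -/
theorem upDownCount_add_upDownCount (n m : ℕ) {w w' : ℕ → Prop} (hw : w n) (hw' : ¬ w' n)
    (h : ∀ i, i ≠ n → (w i ↔ w' i)) :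
    upDownCount (n + 1 + (m + 1)) w + upDownCount (n + 1 + (m + 1)) w' =
      (n + 1 + (m + 1)).choose (n + 1) *
        (upDownCount (n + 1) w * upDownCount (m + 1) fun i => w (n + 1 + i)) := by
  classical
  rw [← card_upDown_except, upDownCount, upDownCount]
  simp only [Nat.card_eq_fintype_card]
  rw [← Fintype.card_subtype_or_disjoint]
  · refine Fintype.card_congr (Equiv.subtypeEquivRight fun σ => ⟨?_, fun H => ?_⟩)
    · rintro (H | H) i hi hn
      · exact H i hi
      · rw [H i hi, h i (by omega)]
    · by_cases hn : σ ⟨n, by omega⟩ < σ ⟨n + 1, by omega⟩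
      · refine Or.inl fun i hi => ?_
        rcases eq_or_ne i n with rfl | hin
        · simp [hn, hw]
        · exact H i hi (by omega)
      · refine Or.inr fun i hi => ?_
        rcases eq_or_ne i n with rfl | hin
        · simp [hn, hw']
        · rw [H i hi (by omega), h i hin]
  · rw [Pi.disjoint_iff]
    intro σ
    rw [Prop.disjoint_iff]
    by_contra! H
    exact hw' ((H.2 n (by omega)).1 ((H.1 n (by omega)).2 hw))

theorem numTwoUpTwoDown_eq_upDownCount (m : ℕ) :
    numTwoUpTwoDown m = upDownCount m fun i => i % 4 < 2 := rfl

/-- The number of permutations of `N` elements following the 2up-2down pattern on the first `p`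
letters and increasing afterwards. -/
noncomputable def twoUpTwoDownThenUp (N p : ℕ) : ℕ :=
  upDownCount N fun i => i % 4 < 2 ∨ p ≤ i

theorem twoUpTwoDownThenUp_zero (N : ℕ) : twoUpTwoDownThenUp N 0 = 1 :=
  upDownCount_of_forall fun _ _ => Or.inr (Nat.zero_le _)

theorem twoUpTwoDownThenUp_of_le {N p : ℕ} (h : N ≤ p + 1) :
    twoUpTwoDownThenUp N p = numTwoUpTwoDown N := by
  rw [numTwoUpTwoDown_eq_upDownCount]
  exact upDownCount_congr fun i hi => by omega

theorem twoUpTwoDownThenUp_succ_of_up {N p : ℕ} (h : p % 4 < 2) :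
    twoUpTwoDownThenUp N (p + 1) = twoUpTwoDownThenUp N p :=
  upDownCount_congr fun i _ => by
    rcases eq_or_ne i p with rfl | hi
    · simp [h]
    · omega

theorem twoUpTwoDownThenUp_add_succ {N p : ℕ} (h : 2 ≤ p % 4) (hN : p + 1 < N) :
    twoUpTwoDownThenUp N p + twoUpTwoDownThenUp N (p + 1) =
      N.choose (p + 1) * numTwoUpTwoDown (p + 1) := by
  obtain ⟨m, rfl⟩ := Nat.exists_eq_add_of_le (show p + 1 + 1 ≤ N by omega)
  rw [show p + 1 + 1 + m = p + 1 + (m + 1) by omega, twoUpTwoDownThenUp, twoUpTwoDownThenUp,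
    upDownCount_add_upDownCount p m (by omega) (by omega) fun i hi => by omega,
    upDownCount_of_forall (m := m + 1) fun i _ => by omega, mul_one,
    ← twoUpTwoDownThenUp_of_le (le_refl (p + 1)), twoUpTwoDownThenUp]

/-- The numbers `A(q)` for `q ≡ 0 (mod 4)`, with a minus sign for `q ≡ 3 (mod 4)`, and `0`
otherwise. -/
noncomputable def signedTwoUpTwoDown (q : ℕ) : ℝ :=
  if q % 4 = 0 then numTwoUpTwoDown q else if q % 4 = 3 then -numTwoUpTwoDown q else 0

theorem numTwoUpTwoDown_zero : numTwoUpTwoDown 0 = 1 := by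
  rw [← twoUpTwoDownThenUp_of_le (Nat.zero_le (0 + 1)), twoUpTwoDownThenUp_zero]

theorem twoUpTwoDownThenUp_four_mul_eq_sum (N k : ℕ) (h : 4 * k < N) :
    (twoUpTwoDownThenUp N (4 * k) : ℝ) =
      ∑ q ∈ Finset.range (4 * k + 1), N.choose q * signedTwoUpTwoDown q := by
  induction k with
  | zero => simp [twoUpTwoDownThenUp_zero, signedTwoUpTwoDown, numTwoUpTwoDown_zero]
  | succ k ih =>
    have h0 := twoUpTwoDownThenUp_succ_of_up (N := N) (p := 4 * k) (by omega)
    have h1 := twoUpTwoDownThenUp_succ_of_up (N := N) (p := 4 * k + 1) (by omega)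
    have h2 := twoUpTwoDownThenUp_add_succ (N := N) (p := 4 * k + 2) (by omega) (by omega)
    have h3 := twoUpTwoDownThenUp_add_succ (N := N) (p := 4 * k + 3) (by omega) (by omega)
    rw [h1, h0] at h2
    have e1 : signedTwoUpTwoDown (4 * k + 1) = 0 := by
      rw [signedTwoUpTwoDown, if_neg (by omega), if_neg (by omega)]
    have e2 : signedTwoUpTwoDown (4 * k + 2) = 0 := by
      rw [signedTwoUpTwoDown, if_neg (by omega), if_neg (by omega)]
    have e3 : signedTwoUpTwoDown (4 * k + 3) = -numTwoUpTwoDown (4 * k + 3) := by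
      rw [signedTwoUpTwoDown, if_neg (by omega), if_pos (by omega)]
    have e4 : signedTwoUpTwoDown (4 * k + 4) = numTwoUpTwoDown (4 * k + 4) := by
      rw [signedTwoUpTwoDown, if_pos (by omega)]
    simp only [show 4 * (k + 1) = 4 * k + 4 by ring, Finset.sum_range_succ _ (4 * k + 4),
      Finset.sum_range_succ _ (4 * k + 3), Finset.sum_range_succ _ (4 * k + 2),
      Finset.sum_range_succ _ (4 * k + 1), ← ih (by omega), e1, e2, e3, e4]
    rify at h2 h3
    linear_combination h3 - h2

theorem sum_choose_mul_signedTwoUpTwoDown (N : ℕ) (hN : N % 4 ≠ 2) :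
    ∑ q ∈ Finset.range (N + 1), N.choose q * signedTwoUpTwoDown q =
      if N = 0 then 1 else if N % 4 = 1 then (numTwoUpTwoDown N : ℝ) else 0 := by
  rcases Nat.eq_zero_or_pos N with rfl | hpos
  · simp [signedTwoUpTwoDown, numTwoUpTwoDown_zero]
  obtain ⟨k, hk⟩ : ∃ k, N = 4 * k + (N - 1) % 4 + 1 := ⟨(N - 1) / 4, by omega⟩
  have h0 := fun n => twoUpTwoDownThenUp_succ_of_up (N := n) (p := 4 * k) (by omega)
  have h1 := fun n => twoUpTwoDownThenUp_succ_of_up (N := n) (p := 4 * k + 1) (by omega)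
  have e1 : signedTwoUpTwoDown (4 * k + 1) = 0 := by
    rw [signedTwoUpTwoDown, if_neg (by omega), if_neg (by omega)]
  have e2 : signedTwoUpTwoDown (4 * k + 2) = 0 := by
    rw [signedTwoUpTwoDown, if_neg (by omega), if_neg (by omega)]
  have e3 : signedTwoUpTwoDown (4 * k + 3) = -numTwoUpTwoDown (4 * k + 3) := by
    rw [signedTwoUpTwoDown, if_neg (by omega), if_pos (by omega)]
  have : (N - 1) % 4 = 3 ∨ (N - 1) % 4 = 0 ∨ (N - 1) % 4 = 2 := by omega
  rcases this with h | h | h <;> rw [h] at hk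
  · have h2 := twoUpTwoDownThenUp_add_succ (N := N) (p := 4 * k + 2) (by omega) (by omega)
    rw [h1, h0, twoUpTwoDownThenUp_of_le (p := 4 * k + 2 + 1) (by omega)] at h2
    have e4 : signedTwoUpTwoDown (4 * k + 4) = numTwoUpTwoDown (4 * k + 4) := by
      rw [signedTwoUpTwoDown, if_pos (by omega)]
    obtain rfl : N = 4 * k + 4 := by omega
    rw [if_neg (by omega), if_neg (by omega)]
    simp only [Finset.sum_range_succ _ (4 * k + 4), Finset.sum_range_succ _ (4 * k + 3),
      Finset.sum_range_succ _ (4 * k + 2), Finset.sum_range_succ _ (4 * k + 1),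
      ← twoUpTwoDownThenUp_four_mul_eq_sum _ k (by omega : 4 * k < 4 * k + 4), e1, e2, e3, e4,
      Nat.choose_self]
    rify at h2
    linear_combination h2
  · subst hk
    rw [if_neg (by omega), if_pos (by omega), Finset.sum_range_succ, e1,
      ← twoUpTwoDownThenUp_four_mul_eq_sum _ _ (by omega), mul_zero, add_zero,
      twoUpTwoDownThenUp_of_le le_rfl]
  · subst hk
    rw [if_neg (by omega), if_neg (by omega), Finset.sum_range_succ, Finset.sum_range_succ,
      Finset.sum_range_succ, e1, e2, e3,
      ← twoUpTwoDownThenUp_four_mul_eq_sum _ _ (by omega), ← h0, ← h1,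
      twoUpTwoDownThenUp_of_le le_rfl, Nat.choose_self]
    simp

/-- The exponential generating function of the numbers `A(q)` over `q ≡ r (mod 4)`. -/
noncomputable def twoUpTwoDownSeries (r : ℕ) : PowerSeries ℝ :=
  PowerSeries.mk fun n => if n % 4 = r then (numTwoUpTwoDown n : ℝ) / n.factorial else 0

theorem coeff_series_mul_olivier {j : ℕ} (hj : j < 4) (n : ℕ) :
    PowerSeries.coeff n (twoUpTwoDownSeries 0 * olivier j -
        twoUpTwoDownSeries 3 * olivier ((j + 1) % 4)) =
      if n % 4 = j then (∑ q ∈ Finset.range (n + 1), n.choose q * signedTwoUpTwoDown q) /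
        n.factorial else 0 := by
  rw [map_sub, PowerSeries.coeff_mul, PowerSeries.coeff_mul, ← Finset.sum_sub_distrib,
    ← Finset.Nat.sum_antidiagonal_eq_sum_range_succ
      (fun q _ => (n.choose q : ℝ) * signedTwoUpTwoDown q), Finset.sum_div]
  trans ∑ x ∈ Finset.HasAntidiagonal.antidiagonal n,
      if n % 4 = j then (n.choose x.1 : ℝ) * signedTwoUpTwoDown x.1 / n.factorial else 0
  swap
  · split_ifs <;> simp
  refine Finset.sum_congr rfl fun x hx => ?_
  obtain ⟨q, r⟩ := x
  obtain rfl : q + r = n := by simpa using hx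
  have hc : ((q + r).choose q : ℝ) / (q + r).factorial = 1 / q.factorial * (1 / r.factorial) := by
    rw [Nat.cast_add_choose]
    field_simp
  simp only [twoUpTwoDownSeries, olivier, signedTwoUpTwoDown, PowerSeries.coeff_mk,
    mul_div_right_comm, hc]
  split_ifs <;> first | omega | ring

theorem two_mul_FP : 2 * FP =
    PowerSeries.X * (twoUpTwoDownSeries 1 + twoUpTwoDownSeries 3) := by
  ext n
  rw [two_mul]
  rcases n with _ | n
  · simp [FP]
  · rw [PowerSeries.coeff_succ_X_mul]
    simp only [FP, sharpP, twoUpTwoDownSeries, PowerSeries.coeff_mk, map_add]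
    by_cases h : (n + 1) % 2 = 0
    · obtain ⟨k, rfl⟩ : ∃ k, n = 2 * k + 1 := ⟨n / 2, by omega⟩
      rw [if_pos (by omega), show (2 * k + 1 + 1) / 2 = k + 1 by omega,
        show 2 * (k + 1) - 1 = 2 * k + 1 by omega, Nat.factorial_succ (2 * k + 1)]
      have hs : ((2 * k + 1).factorial : ℝ) ≠ 0 := by positivity
      have : (2 * k + 1) % 4 = 1 ∨ (2 * k + 1) % 4 = 3 := by omega
      rcases this with h | h <;> simp only [h] <;> push_cast <;> field_simp <;> norm_num <;> ring
    · rw [if_neg (by omega), if_neg (by omega), if_neg (by omega)]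

/-- `2 F_P(x) (φ₀² − φ₁φ₃) = x (φ₀φ₁ − φ₂φ₃ + φ₃)`. -/
theorem genfun_chord_diagrams_path_type :
    2 * FP * (olivier 0 ^ 2 - olivier 1 * olivier 3) =
      PowerSeries.X * (olivier 0 * olivier 1 - olivier 2 * olivier 3 + olivier 3) := by
  have h0 : twoUpTwoDownSeries 0 * olivier 0 - twoUpTwoDownSeries 3 * olivier 1 = 1 := by
    ext n
    rw [coeff_series_mul_olivier (j := 0) (by norm_num), PowerSeries.coeff_one]
    split_ifs with h h' h'
    · rw [sum_choose_mul_signedTwoUpTwoDown n (by omega)]; simp [h']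
    · rw [sum_choose_mul_signedTwoUpTwoDown n (by omega)]; simp [h', h]
    · omega
    · rfl
  have h1 : twoUpTwoDownSeries 0 * olivier 1 - twoUpTwoDownSeries 3 * olivier 2 =
      twoUpTwoDownSeries 1 := by
    ext n
    rw [coeff_series_mul_olivier (j := 1) (by norm_num), twoUpTwoDownSeries, PowerSeries.coeff_mk]
    split_ifs with h
    · rw [sum_choose_mul_signedTwoUpTwoDown n (by omega), if_neg (by omega), if_pos h]
    · rfl
  have h3 : twoUpTwoDownSeries 0 * olivier 3 - twoUpTwoDownSeries 3 * olivier 0 = 0 := by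
    ext n
    rw [coeff_series_mul_olivier (j := 3) (by norm_num), map_zero]
    split_ifs with h
    · rw [sum_choose_mul_signedTwoUpTwoDown n (by omega), if_neg (by omega), if_neg (by omega),
        zero_div]
    · rfl
  rw [two_mul_FP, ← h1]
  linear_combination PowerSeries.X * (olivier 3 * h0 - olivier 0 * h3 +
    olivier 1 * (olivier 0 * h0 - olivier 1 * h3) + olivier 2 * (olivier 0 * h3 - olivier 3 * h0))
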